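/- arXiv:1406.3860 — 3 statements merged into one kernel-verified Lean document; each statement's English description precedes it below -/
import Mathlib

section
/- Let S be a finite nonempty family of nondegenerate closed segments in ℝ² (each segment has two distinct endpoints), let V be the set of all endpoints of segments in S, and let ℓ be a line in ℝ² that meets the relative interior of every segment in S. Then there exist two distinct points v, w ∈ V such that the line through v and w meets every (closed) segment in S. -/
/-- In `ℝ × ℝ`, two points `v`, `w` and a point `x` whose difference vectors have zero
cross product are collinear. -/
theorem exists_eq_add_smul_sub_of_cross_eq_zero {v w x : ℝ × ℝ} (hvw : v ≠ w)
    (h : (w.1 - v.1) * (x.2 - v.2) = (w.2 - v.2) * (x.1 - v.1)) :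
    ∃ t : ℝ, v + t • (w - v) = x := by
  by_cases h1 : w.1 - v.1 = 0
  · have h2 : w.2 - v.2 ≠ 0 := fun h2 => hvw (Prod.ext (by linarith) (by linarith))
    refine ⟨(x.2 - v.2) / (w.2 - v.2), Prod.ext ?_ ?_⟩
    · simp only [Prod.fst_add, Prod.smul_fst, Prod.fst_sub, smul_eq_mul]
      field_simp
      linear_combination h
    · simp only [Prod.snd_add, Prod.smul_snd, Prod.snd_sub, smul_eq_mul]
      field_simp
      ring
  · refine ⟨(x.1 - v.1) / (w.1 - v.1), Prod.ext ?_ ?_⟩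
    · simp only [Prod.fst_add, Prod.smul_fst, Prod.fst_sub, smul_eq_mul]
      field_simp
      ring
    · simp only [Prod.snd_add, Prod.smul_snd, Prod.snd_sub, smul_eq_mul]
      field_simp
      linear_combination -h

/-- If `a` and `b` lie weakly on different sides of the line through `v` and `w`, then this
line meets the segment `[a, b]`. -/
theorem exists_add_smul_sub_mem_segment {v w a b : ℝ × ℝ} (hvw : v ≠ w)
    (ha : 0 ≤ (w.1 - v.1) * (a.2 - v.2) - (w.2 - v.2) * (a.1 - v.1))
    (hb : (w.1 - v.1) * (b.2 - v.2) - (w.2 - v.2) * (b.1 - v.1) ≤ 0) :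
    ∃ t : ℝ, v + t • (w - v) ∈ segment ℝ a b := by
  set α := (w.1 - v.1) * (a.2 - v.2) - (w.2 - v.2) * (a.1 - v.1) with hα
  set β := (w.1 - v.1) * (b.2 - v.2) - (w.2 - v.2) * (b.1 - v.1) with hβ
  rcases ha.eq_or_lt with h0 | hpos
  · obtain ⟨t, ht⟩ := exists_eq_add_smul_sub_of_cross_eq_zero (x := a) hvw (by linarith)
    exact ⟨t, ht ▸ left_mem_segment ℝ a b⟩
  · have hne : 0 < α - β := by linarith
    obtain ⟨t, ht⟩ := exists_eq_add_smul_sub_of_cross_eq_zero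
      (x := (-β / (α - β)) • a + (α / (α - β)) • b) hvw (by
        simp only [Prod.fst_add, Prod.smul_fst, Prod.snd_add, Prod.smul_snd, smul_eq_mul]
        field_simp
        rw [hα, hβ]
        ring)
    refine ⟨t, ht ▸ ⟨_, _, div_nonneg (by linarith) hne.le, div_nonneg ha hne.le, ?_, rfl⟩⟩
    field_simp
    ring

theorem support_vertices
    (S : Finset ((ℝ × ℝ) × (ℝ × ℝ))) (hS : S.Nonempty)
    (hnd : ∀ s ∈ S, s.1 ≠ s.2)
    (p d : ℝ × ℝ) (hd : d ≠ 0)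
    (hmeets : ∀ s ∈ S, ∃ t : ℝ, p + t • d ∈ openSegment ℝ s.1 s.2) :
    ∃ v w : ℝ × ℝ,
      (∃ s ∈ S, v = s.1 ∨ v = s.2) ∧
      (∃ s ∈ S, w = s.1 ∨ w = s.2) ∧
      v ≠ w ∧
      ∀ s ∈ S, ∃ t : ℝ, v + t • (w - v) ∈ segment ℝ s.1 s.2 := by
  have hdd : 0 < d.1 ^ 2 + d.2 ^ 2 := by
    by_contra! hle
    exact hd (Prod.ext (by simp; nlinarith [sq_nonneg d.1, sq_nonneg d.2])
      (by simp; nlinarith [sq_nonneg d.1, sq_nonneg d.2]))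
  -- `h` is the signed height over the given line, `u` the coordinate along it.
  let h : ℝ × ℝ → ℝ := fun x => d.1 * (x.2 - p.2) - d.2 * (x.1 - p.1)
  let u : ℝ × ℝ → ℝ := fun x => d.1 * x.1 + d.2 * x.2
  have hcomb : ∀ s ∈ S, ∃ α β : ℝ, 0 < α ∧ 0 < β ∧ α * h s.1 + β * h s.2 = 0 := by
    intro s hs
    obtain ⟨t, α, β, hα, hβ, hαβ, heq⟩ := hmeets s hs
    refine ⟨α, β, hα, hβ, ?_⟩
    have e1 := congrArg Prod.fst heq
    have e2 := congrArg Prod.snd heq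
    simp only [Prod.fst_add, Prod.smul_fst, Prod.snd_add, Prod.smul_snd, smul_eq_mul] at e1 e2
    simp only [h]
    linear_combination d.1 * e2 - d.2 * e1 + (d.2 * p.1 - d.1 * p.2) * hαβ
  by_cases hflat : ∃ s ∈ S, h s.1 = 0
  · obtain ⟨s, hs, h1⟩ := hflat
    have h2 : h s.2 = 0 := by
      obtain ⟨α, β, -, hβ, hz⟩ := hcomb s hs
      rw [h1, mul_zero, zero_add] at hz
      exact (mul_eq_zero.1 hz).resolve_left hβ.ne'
    refine ⟨s.1, s.2, ⟨s, hs, .inl rfl⟩, ⟨s, hs, .inr rfl⟩, hnd s hs, fun r hr => ?_⟩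
    obtain ⟨t, ht⟩ := hmeets r hr
    obtain ⟨τ, hτ⟩ := exists_eq_add_smul_sub_of_cross_eq_zero (x := p + t • d) (hnd s hs) (by
      simp only [Prod.fst_add, Prod.smul_fst, Prod.snd_add, Prod.smul_snd, smul_eq_mul]
      simp only [h] at h1 h2
      refine mul_left_cancel₀ hdd.ne' ?_
      linear_combination
        (d.1 * (p.1 + t * d.1 - s.2.1) + d.2 * (p.2 + t * d.2 - s.2.2)) * h1
          - (d.1 * (p.1 + t * d.1 - s.1.1) + d.2 * (p.2 + t * d.2 - s.1.2)) * h2)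
    exact ⟨τ, hτ ▸ openSegment_subset_segment ℝ _ _ ht⟩
  · push Not at hflat
    have hsides : ∀ s : S, ∃ a b : ℝ × ℝ,
        (a = s.1.1 ∧ b = s.1.2 ∨ a = s.1.2 ∧ b = s.1.1) ∧ 0 < h a ∧ h b < 0 := by
      rintro ⟨s, hs⟩
      obtain ⟨α, β, hα, hβ, hz⟩ := hcomb s hs
      rcases (hflat s hs).lt_or_gt with hlt | hgt
      · refine ⟨s.2, s.1, .inr ⟨rfl, rfl⟩, ?_, hlt⟩
        by_contra! hle
        nlinarith [mul_neg_of_pos_of_neg hα hlt, mul_nonpos_of_nonneg_of_nonpos hβ.le hle]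
      · refine ⟨s.1, s.2, .inl ⟨rfl, rfl⟩, hgt, ?_⟩
        by_contra! hle
        nlinarith [mul_pos hα hgt, mul_nonneg hβ.le hle]
    choose a b hab ha hb using hsides
    have : Nonempty S := hS.to_subtype
    obtain ⟨⟨i, j⟩, hmax⟩ := Finite.exists_max
      fun q : S × S => (u (a q.1) - u (b q.2)) / (h (a q.1) - h (b q.2))
    have hpos : ∀ k l, 0 < h (a k) - h (b l) := fun k l => by linarith [ha k, hb l]
    refine ⟨b j, a i, ⟨j, j.2, ?_⟩, ⟨i, i.2, ?_⟩, ?_, fun s hs => ?_⟩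
    · rcases hab j with ⟨-, e⟩ | ⟨-, e⟩ <;> simp [e]
    · rcases hab i with ⟨e, -⟩ | ⟨e, -⟩ <;> simp [e]
    · intro e
      have := hpos i j
      rw [e] at this
      linarith
    · have hne : b j ≠ a i := fun e => by
        have := hpos i j
        rw [e] at this
        linarith
      have hA := hmax (⟨s, hs⟩, j)
      have hB := hmax (i, ⟨s, hs⟩)
      rw [div_le_div_iff₀ (hpos _ _) (hpos _ _)] at hA hB
      obtain ⟨t, ht⟩ := exists_add_smul_sub_mem_segment (a := a ⟨s, hs⟩) (b := b ⟨s, hs⟩) hne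
        (by
          refine le_of_mul_le_mul_left ?_ hdd
          simp only [h, u] at hA
          linarith)
        (by
          refine le_of_mul_le_mul_left ?_ hdd
          simp only [h, u] at hB
          linarith)
      rcases hab ⟨s, hs⟩ with ⟨e1, e2⟩ | ⟨e1, e2⟩
      · exact ⟨t, by rwa [e1, e2] at ht⟩
      · exact ⟨t, by rwa [e1, e2, segment_symm] at ht⟩
end

section
/- Let S be a finite nonempty family of nondegenerate closed segments in ℝ² (each segment has two distinct endpoints), let V be the set of all endpoints of segments in S, and let ℓ be a line in ℝ² that meets the relative interior of every segment in S. Then there exists a point v ∈ V such that the line through v parallel to ℓ (i.e., the translate of ℓ passing through v) meets every (closed) segment in S. -/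
/-- The linear functional `x ↦ x.1 * d.2 - x.2 * d.1`, which is constant exactly on the lines with
direction `d`. -/
def crossWith (d : ℝ × ℝ) : ℝ × ℝ →ₗ[ℝ] ℝ :=
  d.2 • LinearMap.fst ℝ ℝ ℝ - d.1 • LinearMap.snd ℝ ℝ ℝ

theorem crossWith_apply (d x : ℝ × ℝ) : crossWith d x = d.2 * x.1 - d.1 * x.2 := by
  simp [crossWith]

theorem crossWith_add_smul (d v : ℝ × ℝ) (t : ℝ) :
    crossWith d (v + t • d) = crossWith d v := by
  simp only [crossWith_apply, Prod.fst_add, Prod.snd_add, Prod.smul_fst, Prod.smul_snd, smul_eq_mul]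
  ring

theorem exists_add_smul_eq_of_crossWith_eq {d v w : ℝ × ℝ} (hd : d ≠ 0)
    (h : crossWith d v = crossWith d w) : ∃ t : ℝ, v + t • d = w := by
  simp only [crossWith_apply] at h
  by_cases h1 : d.1 = 0
  · have h2 : d.2 ≠ 0 := fun h2 => hd (Prod.ext h1 h2)
    refine ⟨(w.2 - v.2) / d.2, Prod.ext ?_ ?_⟩
    · have : v.1 = w.1 := mul_left_cancel₀ h2 (by simpa [h1] using h)
      simp [h1, this]
    · simp [h2]
  · refine ⟨(w.1 - v.1) / d.1, Prod.ext ?_ ?_⟩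
    · simp [h1]
    · simp only [Prod.snd_add, Prod.smul_snd, smul_eq_mul]
      field_simp
      linarith

theorem LinearMap.image_segment_eq_uIcc {E : Type*} [AddCommGroup E] [Module ℝ E]
    (f : E →ₗ[ℝ] ℝ) (a b : E) : f '' segment ℝ a b = Set.uIcc (f a) (f b) := by
  rw [← segment_eq_uIcc]
  exact image_segment ℝ f.toAffineMap a b


/-- If a line `{p + t•d}` meets the relative interior (open segment) of every
segment in a finite nonempty family `S` of nondegenerate segments, then there is a
segment endpoint `v` such that the parallel line through `v` (the translate of the
given line passing through `v`) meets every (closed) segment of `S`. -/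
theorem parallel_support_line
    (S : Finset ((ℝ × ℝ) × (ℝ × ℝ))) (hS : S.Nonempty)
    (hnd : ∀ s ∈ S, s.1 ≠ s.2)
    (p d : ℝ × ℝ) (hd : d ≠ 0)
    (hmeets : ∀ s ∈ S, ∃ t : ℝ, p + t • d ∈ openSegment ℝ s.1 s.2) :
    ∃ v : ℝ × ℝ,
      (∃ s ∈ S, v = s.1 ∨ v = s.2) ∧
      ∀ s ∈ S, ∃ t : ℝ, v + t • d ∈ segment ℝ s.1 s.2 := by
  obtain ⟨s₀, hs₀, hmin⟩ :=
    S.exists_min_image (fun s => max (crossWith d s.1) (crossWith d s.2)) hS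
  obtain ⟨v, hv, hfv⟩ : ∃ v, (v = s₀.1 ∨ v = s₀.2) ∧
      crossWith d v = max (crossWith d s₀.1) (crossWith d s₀.2) := by
    rcases max_choice (crossWith d s₀.1) (crossWith d s₀.2) with h | h
    · exact ⟨s₀.1, Or.inl rfl, h.symm⟩
    · exact ⟨s₀.2, Or.inr rfl, h.symm⟩
  have hp : ∀ s ∈ S, crossWith d p ∈ Set.uIcc (crossWith d s.1) (crossWith d s.2) := by
    intro s hs
    obtain ⟨t, ht⟩ := hmeets s hs
    rw [← LinearMap.image_segment_eq_uIcc, ← crossWith_add_smul d p t]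
    exact Set.mem_image_of_mem _ (openSegment_subset_segment ℝ _ _ ht)
  refine ⟨v, ⟨s₀, hs₀, hv⟩, fun s hs => ?_⟩
  have hvs : crossWith d v ∈ Set.uIcc (crossWith d s.1) (crossWith d s.2) := by
    rw [hfv]
    exact ⟨(hp s hs).1.trans (hp s₀ hs₀).2, hmin s hs⟩
  rw [← LinearMap.image_segment_eq_uIcc] at hvs
  obtain ⟨w, hw, hwv⟩ := hvs
  obtain ⟨t, rfl⟩ := exists_add_smul_eq_of_crossWith_eq hd hwv.symm
  exact ⟨t, hw⟩
end

section
/- Let p, a, b ∈ ℝ² with a ≠ b, and let D be the set of unit vectors d ∈ ℝ² such that the line {p + t·d : t ∈ ℝ} meets the closed segment [a,b]. Then (i) D is a closed subset of the unit circle, and (ii) if d ∈ D and the line {p + t·d : t ∈ ℝ} contains neither a nor b, then d lies in the interior of D relative to the unit circle (all unit vectors sufficiently close to d also lie in D). -/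
/-- The planar cross product of `d` with `x - p`. -/
def crossFrom (p d x : EuclideanSpace ℝ (Fin 2)) : ℝ :=
  d 0 * (x 1 - p 1) - d 1 * (x 0 - p 0)

theorem crossFrom_add_smul (p d : EuclideanSpace ℝ (Fin 2)) (t : ℝ) :
    crossFrom p d (p + t • d) = 0 := by
  simp [crossFrom]
  ring

theorem crossFrom_combo (p d a b : EuclideanSpace ℝ (Fin 2)) {u v : ℝ} (huv : u + v = 1) :
    crossFrom p d (u • a + v • b) = u * crossFrom p d a + v * crossFrom p d b := by
  obtain rfl : u = 1 - v := by linarith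
  simp [crossFrom]
  ring

theorem continuous_crossFrom (p x : EuclideanSpace ℝ (Fin 2)) :
    Continuous fun d => crossFrom p d x := by
  unfold crossFrom
  fun_prop

theorem exists_add_smul_eq_of_crossFrom_eq_zero {p d x : EuclideanSpace ℝ (Fin 2)}
    (hd : ‖d‖ = 1) (h : crossFrom p d x = 0) : ∃ t : ℝ, p + t • d = x := by
  have hsq : d 0 ^ 2 + d 1 ^ 2 = 1 := by
    have := EuclideanSpace.real_norm_sq_eq d
    rw [hd, Fin.sum_univ_two] at this
    linarith
  refine ⟨d 0 * (x 0 - p 0) + d 1 * (x 1 - p 1), ?_⟩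
  unfold crossFrom at h
  ext i
  fin_cases i
  · simp
    linear_combination (x 0 - p 0) * hsq + d 1 * h
  · simp
    linear_combination (x 1 - p 1) * hsq - d 0 * h

/-- A line through `p` that strictly separates `a` from `b` meets the segment `[a, b]`. -/
theorem exists_add_smul_mem_segment_of_crossFrom_mul_neg {p d a b : EuclideanSpace ℝ (Fin 2)}
    (hd : ‖d‖ = 1) (h : crossFrom p d a * crossFrom p d b < 0) :
    ∃ t : ℝ, p + t • d ∈ segment ℝ a b := by
  obtain ⟨u, v, hu, hv, huv, h0⟩ : ∃ u v : ℝ, 0 ≤ u ∧ 0 ≤ v ∧ u + v = 1 ∧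
      u * crossFrom p d a + v * crossFrom p d b = 0 := by
    have hmem : (0 : ℝ) ∈ segment ℝ (crossFrom p d a) (crossFrom p d b) := by
      rw [segment_eq_uIcc, Set.mem_uIcc]
      rcases mul_neg_iff.1 h with h | h
      · exact Or.inr ⟨h.2.le, h.1.le⟩
      · exact Or.inl ⟨h.1.le, h.2.le⟩
    simpa [segment] using hmem
  rw [← crossFrom_combo p d a b huv] at h0
  obtain ⟨t, ht⟩ := exists_add_smul_eq_of_crossFrom_eq_zero hd h0
  exact ⟨t, u, v, hu, hv, huv, ht.symm⟩

theorem crossFrom_mul_neg_of_add_smul_mem_segment {p d a b : EuclideanSpace ℝ (Fin 2)}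
    (hd : ‖d‖ = 1) {t : ℝ} (ht : p + t • d ∈ segment ℝ a b)
    (ha : ∀ t : ℝ, p + t • d ≠ a) (hb : ∀ t : ℝ, p + t • d ≠ b) :
    crossFrom p d a * crossFrom p d b < 0 := by
  have ha0 : crossFrom p d a ≠ 0 := fun h =>
    let ⟨s, hs⟩ := exists_add_smul_eq_of_crossFrom_eq_zero hd h
    ha s hs
  have hb0 : crossFrom p d b ≠ 0 := fun h =>
    let ⟨s, hs⟩ := exists_add_smul_eq_of_crossFrom_eq_zero hd h
    hb s hs
  obtain ⟨u, v, hu, hv, huv, h⟩ := ht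
  have h0 := crossFrom_add_smul p d t
  rw [← h, crossFrom_combo p d a b huv] at h0
  by_contra! hnn
  have hpos := lt_of_le_of_ne hnn (mul_ne_zero ha0 hb0).symm
  have hA : u * crossFrom p d a ^ 2 + v * (crossFrom p d a * crossFrom p d b) = 0 := by
    linear_combination crossFrom p d a * h0
  have hA2 := sq_pos_of_ne_zero ha0
  have h1 := mul_nonneg hu hA2.le
  have h2 := mul_nonneg hv hpos.le
  have hu0 : u = 0 := (mul_eq_zero.1 (by linarith)).resolve_right hA2.ne'
  have hv0 : v = 0 := (mul_eq_zero.1 (by linarith)).resolve_right hpos.ne'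
  linarith

/-- The unit directions of the lines through `p` that meet a compact set form a closed set. -/
theorem isClosed_setOf_unit_direction_of_isCompact {E : Type*} [NormedAddCommGroup E]
    [NormedSpace ℝ E] (p : E) {K : Set E} (hK : IsCompact K) :
    IsClosed {d : E | d ∈ Metric.sphere (0 : E) 1 ∧ ∃ t : ℝ, p + t • d ∈ K} := by
  obtain ⟨R, hR⟩ := hK.isBounded.subset_closedBall p
  have hS : IsClosed {q : E × Set.Icc (-R) R |
      q.1 ∈ Metric.sphere (0 : E) 1 ∧ p + (q.2 : ℝ) • q.1 ∈ K} :=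
    (Metric.isClosed_sphere.preimage continuous_fst).inter
      (hK.isClosed.preimage (by fun_prop))
  convert isClosedMap_fst_of_compactSpace _ hS using 1
  ext d
  constructor
  · rintro ⟨hd, t, ht⟩
    have hnorm : |t| ≤ R := by
      simpa [dist_eq_norm, norm_smul, mem_sphere_zero_iff_norm.1 hd] using hR ht
    exact ⟨(d, ⟨t, abs_le.1 hnorm⟩), ⟨hd, ht⟩, rfl⟩
  · rintro ⟨⟨d, t⟩, ⟨hd, ht⟩, rfl⟩
    exact ⟨hd, t, ht⟩


/-- Persistence of intersection under rotation of a line about a point `p`.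
Let `D` be the set of unit directions `d` (on the Euclidean unit circle) such that
the line `{p + t•d}` meets the closed segment `[a,b]`.
(i) `D` is closed; (ii) if `d ∈ D` and the line `{p + t•d}` contains neither `a`
nor `b`, then every unit direction sufficiently close to `d` is also in `D`. -/
theorem direction_set_closed_and_interior
    (p a b : EuclideanSpace ℝ (Fin 2)) (hab : a ≠ b) :
    IsClosed {d : EuclideanSpace ℝ (Fin 2) |
        d ∈ Metric.sphere (0 : EuclideanSpace ℝ (Fin 2)) 1 ∧
        ∃ t : ℝ, p + t • d ∈ segment ℝ a b} ∧
    ∀ d : EuclideanSpace ℝ (Fin 2),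
      d ∈ Metric.sphere (0 : EuclideanSpace ℝ (Fin 2)) 1 →
      (∃ t : ℝ, p + t • d ∈ segment ℝ a b) →
      (∀ t : ℝ, p + t • d ≠ a) → (∀ t : ℝ, p + t • d ≠ b) →
      ∃ ε > (0 : ℝ), ∀ d' : EuclideanSpace ℝ (Fin 2),
        d' ∈ Metric.sphere (0 : EuclideanSpace ℝ (Fin 2)) 1 → ‖d' - d‖ < ε →
        ∃ t : ℝ, p + t • d' ∈ segment ℝ a b := by
  refine ⟨isClosed_setOf_unit_direction_of_isCompact p ?_, ?_⟩
  · rw [← convexHull_pair]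
    exact (Set.toFinite {a, b}).isCompact_convexHull ℝ
  · rintro d hd ⟨t, ht⟩ ha hb
    have hneg := crossFrom_mul_neg_of_add_smul_mem_segment
      (mem_sphere_zero_iff_norm.1 hd) ht ha hb
    have hcont := (continuous_crossFrom p a).mul (continuous_crossFrom p b)
    obtain ⟨ε, hε, hball⟩ :=
      Metric.eventually_nhds_iff.1 (hcont.continuousAt.eventually_lt_const hneg)
    exact ⟨ε, hε, fun d' hd' hdist =>
      exists_add_smul_mem_segment_of_crossFrom_mul_neg (mem_sphere_zero_iff_norm.1 hd')
        (hball (by rwa [dist_eq_norm]))⟩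
end
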